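/- arXiv:0903.2144 — 2 statements merged into one kernel-verified Lean document; each statement's English description precedes it below -/
import Mathlib

section
/- For fixed d ≥ 3 and integers m, n ≥ 2, the proper polynomial maps f_{d,n}(x,y) = (x, y^d − d·xⁿ·y) and f_{d,m}(x,y) = (x, y^d − d·x^m·y) are equivalent if and only if m = n. In particular, there exist infinitely many pairwise non-equivalent proper polynomial maps ℂ² → ℂ² of topological degree d. -/
open MvPolynomial

/-- A polynomial map `ℂ² → ℂ²`, given by a pair of polynomials. -/
abbrev PolyPair := MvPolynomial (Fin 2) ℂ × MvPolynomial (Fin 2) ℂ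

/-- Evaluation of a polynomial pair as a map `ℂ² → ℂ²`. -/
noncomputable def PolyPair.evalMap (f : PolyPair) (p : ℂ × ℂ) : ℂ × ℂ :=
  (MvPolynomial.eval ![p.1, p.2] f.1, MvPolynomial.eval ![p.1, p.2] f.2)

/-- A polynomial pair is a polynomial automorphism of `ℂ²` if it has a polynomial
inverse. -/
def PolyPair.IsPolyAuto (Φ : PolyPair) : Prop :=
  ∃ Ψ : PolyPair, Φ.evalMap ∘ Ψ.evalMap = id ∧ Ψ.evalMap ∘ Φ.evalMap = id

/-- Two polynomial maps are equivalent if `f₂ = Φ₂ ∘ f₁ ∘ Φ₁` for polynomial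
automorphisms `Φ₁, Φ₂` of `ℂ²`. -/
def PolyPair.Equivalent (f₁ f₂ : PolyPair) : Prop :=
  ∃ Φ₁ Φ₂ : PolyPair, Φ₁.IsPolyAuto ∧ Φ₂.IsPolyAuto ∧
    f₂.evalMap = Φ₂.evalMap ∘ f₁.evalMap ∘ Φ₁.evalMap

/-- The map `f_{d,n}(x,y) = (x, y^d − d·xⁿ·y)`. -/
noncomputable def fdn (d n : ℕ) : PolyPair :=
  (X 0, X 1 ^ d - C (d : ℂ) * X 0 ^ n * X 1)

namespace FdnAux

abbrev A := MvPolynomial (Fin 2) ℂ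

/-- substitution -/
noncomputable def sub (F : PolyPair) : A →ₐ[ℂ] A := aeval ![F.1, F.2]

lemma eval_sub (F : PolyPair) (p : A) (z : ℂ × ℂ) :
    eval ![z.1, z.2] (sub F p) = eval ![(F.evalMap z).1, (F.evalMap z).2] p := by
  unfold sub PolyPair.evalMap
  induction p using MvPolynomial.induction_on with
  | C a => simp
  | add p q hp hq => rw [map_add, map_add, hp, hq, map_add]
  | mul_X p i hp =>
    rw [map_mul, map_mul, hp, map_mul]
    fin_cases i <;> simp

lemma ext_eval {p q : A} (h : ∀ z : ℂ × ℂ, eval ![z.1, z.2] p = eval ![z.1, z.2] q) : p = q := by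
  apply MvPolynomial.funext
  intro x
  have := h (x 0, x 1)
  have hx : (![x 0, x 1] : Fin 2 → ℂ) = x := by ext i; fin_cases i <;> rfl
  simpa [hx] using this

lemma sub_sub_of_comp (F G : PolyPair) (h : F.evalMap ∘ G.evalMap = id) (p : A) :
    sub G (sub F p) = p := by
  apply ext_eval
  intro z
  rw [eval_sub, eval_sub]
  have := congrFun h z
  simp only [Function.comp, id] at this
  rw [this]

lemma sub_X0 (F : PolyPair) : sub F (X 0) = F.1 := by simp [sub]
lemma sub_X1 (F : PolyPair) : sub F (X 1) = F.2 := by simp [sub]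

lemma pderiv_sub (F : PolyPair) (i : Fin 2) (p : A) :
    pderiv i (sub F p) = sub F (pderiv 0 p) * pderiv i F.1 + sub F (pderiv 1 p) * pderiv i F.2 := by
  induction p using MvPolynomial.induction_on with
  | C a => simp [sub]
  | add p q hp hq => simp only [map_add, hp, hq]; ring
  | mul_X p j hp =>
    fin_cases j
    · simp only [Fin.zero_eta, map_mul, Derivation.leibniz, hp, smul_eq_mul, sub_X0, map_add,
        pderiv_X_self, pderiv_X_of_ne (show (0 : Fin 2) ≠ 1 by decide), map_one, map_zero]
      ring
    · simp only [Fin.mk_one, map_mul, Derivation.leibniz, hp, smul_eq_mul, sub_X1, map_add,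
        pderiv_X_self, pderiv_X_of_ne (show (1 : Fin 2) ≠ 0 by decide), map_one, map_zero]
      ring

noncomputable def J (F : PolyPair) : A := pderiv 0 F.1 * pderiv 1 F.2 - pderiv 1 F.1 * pderiv 0 F.2

/-- G after F -/
noncomputable def cmp (G F : PolyPair) : PolyPair := (sub F G.1, sub F G.2)

lemma J_cmp (G F : PolyPair) : J (cmp G F) = sub F (J G) * J F := by
  simp only [J, cmp, pderiv_sub, map_sub, map_mul]
  ring

lemma evalMap_cmp (G F : PolyPair) : (cmp G F).evalMap = G.evalMap ∘ F.evalMap := by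
  funext z
  simp only [cmp, Function.comp]
  rw [PolyPair.evalMap, eval_sub, eval_sub]
  rfl

lemma evalMap_inj {F G : PolyPair} (h : F.evalMap = G.evalMap) : F = G := by
  apply Prod.ext
  · exact ext_eval fun z => congrArg Prod.fst (congrFun h z)
  · exact ext_eval fun z => congrArg Prod.snd (congrFun h z)

lemma evalMap_id : PolyPair.evalMap (X 0, X 1) = id := by
  funext z; simp [PolyPair.evalMap]

lemma J_unit {F : PolyPair} (h : F.IsPolyAuto) : IsUnit (J F) := by
  obtain ⟨G, h1, h2⟩ := h
  rw [← evalMap_cmp, ← evalMap_id] at h2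
  have := congrArg J (evalMap_inj h2)
  rw [J_cmp] at this
  have h3 : J (X 0, X 1) = 1 := by
    simp [J]
  rw [h3] at this
  exact IsUnit.of_mul_eq_one_right _ this

noncomputable def P (d n : ℕ) : A := X 1 ^ (d - 1) - X 0 ^ n

lemma J_fdn (d n : ℕ) : J (fdn d n) = C (d : ℂ) * P d n := by
  simp [J, fdn, P, Derivation.leibniz, Derivation.leibniz_pow]
  ring

def R (d n m : ℕ) : Prop := ∃ F G : PolyPair, (∀ p, sub G (sub F p) = p) ∧ (∀ p, sub F (sub G p) = p)
  ∧ ∃ c : ℂ, c ≠ 0 ∧ sub F (P d n) = C c * P d m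

lemma R_symm {d n m : ℕ} (h : R d n m) : R d m n := by
  obtain ⟨F, G, h1, h2, c, hc, h⟩ := h
  refine ⟨G, F, h2, h1, c⁻¹, inv_ne_zero hc, ?_⟩
  have := congrArg (sub G) h
  rw [h1, map_mul] at this
  rw [this, ← algebraMap_eq, AlgHom.commutes, ← mul_assoc, ← map_mul, inv_mul_cancel₀ hc]
  simp

lemma R_of_equiv {d n m : ℕ} (hd : 3 ≤ d) (h : (fdn d n).Equivalent (fdn d m)) : R d n m := by
  obtain ⟨F, H, hF, hH, h⟩ := h
  have hJF := J_unit hF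
  have hJH := J_unit hH
  obtain ⟨G, hG1, hG2⟩ := hF
  refine ⟨F, G, sub_sub_of_comp _ _ hG1, sub_sub_of_comp _ _ hG2, ?_⟩
  rw [← evalMap_cmp, ← evalMap_cmp] at h
  have h := congrArg J (evalMap_inj h)
  rw [J_cmp, J_cmp, J_fdn, J_fdn, map_mul, ← algebraMap_eq, AlgHom.commutes] at h
  have hd0 : (algebraMap ℂ A (d : ℂ)) ≠ 0 := by
    rw [algebraMap_eq, Ne, C_eq_zero]; exact_mod_cast (by omega : d ≠ 0)
  have hu : IsUnit (sub (cmp (fdn d n) F) (J H) * J F) := (hJH.map _).mul hJF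
  obtain ⟨c, hc, hcu⟩ := (MvPolynomial.isUnit_iff_eq_C_of_isReduced).1 hu
  have h' : P d m = C c * sub F (P d n) := by
    apply mul_left_cancel₀ hd0
    rw [h, ← hcu]; ring
  have hc0 := hc.ne_zero
  refine ⟨c⁻¹, inv_ne_zero hc0, ?_⟩
  rw [h', ← mul_assoc, ← map_mul, inv_mul_cancel₀ hc0]; simp

noncomputable def I (d n : ℕ) : Ideal A := Ideal.span {X 0 ^ (n - 1), X 1 ^ (d - 2)}

lemma C_mul_mem {K : Ideal A} {c : ℂ} (hc : c ≠ 0) {p : A} : C c * p ∈ K ↔ p ∈ K := by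
  constructor
  · intro h
    have := K.mul_mem_left (C c⁻¹) h
    rwa [← mul_assoc, ← map_mul, inv_mul_cancel₀ hc, map_one, one_mul] at this
  · exact K.mul_mem_left _

lemma pd0 (d n : ℕ) : pderiv 0 (P d n) = C (-(n : ℂ)) * X 0 ^ (n - 1) := by
  simp [P, Derivation.leibniz_pow]

lemma pd1 (d n : ℕ) : pderiv 1 (P d n) = C ((d - 1 : ℕ) : ℂ) * X 1 ^ (d - 2) := by
  simp [P, Derivation.leibniz_pow, Nat.sub_sub]

/-- `I_m ⊆ φ(I_n)`, in the form of preimages under the inverse. -/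
lemma sub_mem {d n m : ℕ} (hd : 3 ≤ d) (hm : 2 ≤ m) {F G : PolyPair}
    (h1 : ∀ p, sub G (sub F p) = p) {c : ℂ} (hc : c ≠ 0)
    (h : sub F (P d n) = C c * P d m) {p : A} (hp : p ∈ I d m) : sub G p ∈ I d n := by
  have key : ∀ i, sub G (pderiv i (P d m)) ∈ I d n := by
    intro i
    have := congrArg (fun q => sub G (pderiv i q)) h
    simp only [pderiv_sub, map_add, map_mul, h1, pderiv_C_mul] at this
    rw [← C_mul_mem hc]
    have hC : sub G (C c) = C c := (sub G).commutes c
    rw [hC] at this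
    rw [← this, pd0, pd1]
    refine Ideal.add_mem _ ?_ ?_
    · exact Ideal.mul_mem_right _ _ (Ideal.mul_mem_left _ _ (Ideal.subset_span (by simp)))
    · exact Ideal.mul_mem_right _ _ (Ideal.mul_mem_left _ _ (Ideal.subset_span (by simp)))
  have : I d m ≤ (I d n).comap (sub G) := by
    rw [I, Ideal.span_le]
    have hC : ∀ c, sub G (C c) = C c := (sub G).commutes
    rintro q (rfl | rfl)
    · have := key 0
      rw [pd0, map_mul, hC, C_mul_mem] at this
      · exact this
      · simp; omega
    · have := key 1
      rw [pd1, map_mul, hC, C_mul_mem] at this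
      · exact this
      · exact_mod_cast (by omega : d - 1 ≠ 0)
  exact this hp

noncomputable def M : Ideal A := Ideal.span {X 0, X 1}

lemma M_eq : M = RingHom.ker (constantCoeff : A →+* ℂ) := by
  have hM : M = Ideal.span (X '' (Set.univ : Set (Fin 2))) := by
    rw [M]; congr 1; ext p; simp [Fin.exists_fin_two, eq_comm]
  ext p
  rw [hM, mem_ideal_span_X_image, RingHom.mem_ker, constantCoeff_eq]
  constructor
  · intro h
    by_contra h0
    obtain ⟨i, -, hi⟩ := h 0 (mem_support_iff.2 h0)
    exact hi rfl
  · intro h m hm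
    by_contra hcon
    push Not at hcon
    have : m = 0 := by ext i; exact hcon i (Set.mem_univ i)
    rw [this, mem_support_iff] at hm
    exact hm h

lemma mem_M_of_pow {p : A} {k : ℕ} (h : p ^ k ∈ M) : p ∈ M := by
  rw [M_eq, RingHom.mem_ker, map_pow] at h
  rw [M_eq, RingHom.mem_ker]
  exact eq_zero_of_pow_eq_zero h

lemma I_le_M {d n : ℕ} (hd : 3 ≤ d) (hn : 2 ≤ n) : I d n ≤ M := by
  rw [I, Ideal.span_le]
  rintro q (rfl | rfl)
  · exact Ideal.pow_mem_of_mem _ (Ideal.subset_span (by simp)) _ (by omega)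
  · exact Ideal.pow_mem_of_mem _ (Ideal.subset_span (by simp)) _ (by omega)

lemma pow_M_le {d n k : ℕ} (hk : d + n ≤ k + 4) : M ^ k ≤ I d n := by
  rw [M, Ideal.span_insert, ← Ideal.add_eq_sup, add_pow, Ideal.sum_eq_sup]
  apply Finset.sup_le
  intro i hi
  refine Ideal.mul_le_left.trans ?_
  rw [Ideal.span_singleton_pow, Ideal.span_singleton_pow]
  by_cases h : n - 1 ≤ i
  · refine Ideal.mul_le_left.trans ?_
    rw [Ideal.span_singleton_le_iff_mem]
    exact Ideal.mem_of_dvd _ (pow_dvd_pow _ h) (Ideal.subset_span (by simp))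
  · refine Ideal.mul_le_right.trans ?_
    rw [Ideal.span_singleton_le_iff_mem]
    exact Ideal.mem_of_dvd _ (pow_dvd_pow _ (show d - 2 ≤ k - i by omega))
      (Ideal.subset_span (by simp))

lemma not_mem {d m : ℕ} (hd : 3 ≤ d) (hm : 2 ≤ m) : (X 0 ^ (m-2) * X 1 ^ (d-3) : A) ∉ I d m := by
  intro h
  rw [I, Ideal.mem_span_pair] at h
  obtain ⟨a, b, h⟩ := h
  have := congrArg (coeff (Finsupp.single 0 (m-2) + Finsupp.single 1 (d-3))) h
  simp only [X_pow_eq_monomial, monomial_mul, coeff_add, coeff_mul_monomial', coeff_monomial] at this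
  rw [if_neg, if_neg] at this
  · simp at this
  · intro hle
    have := hle 1
    simp at this
    omega
  · intro hle
    have := hle 0
    simp at this
    omega

lemma not_R {d n m : ℕ} (hd : 3 ≤ d) (hn : 2 ≤ n) (hnm : n < m) : ¬ R d n m := by
  intro h
  obtain ⟨F, G, h1, h2, c, hc, h⟩ := h
  obtain ⟨c', hc', h'⟩ : ∃ c : ℂ, c ≠ 0 ∧ sub G (P d m) = C c * P d n := by
    refine ⟨c⁻¹, inv_ne_zero hc, ?_⟩
    have := congrArg (sub G) h
    rw [h1, map_mul] at this
    rw [this, ← algebraMap_eq, AlgHom.commutes, ← mul_assoc, ← map_mul, inv_mul_cancel₀ hc]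
    simp
  have hx : sub G (X 0) ∈ M := by
    apply mem_M_of_pow (k := m - 1)
    rw [← map_pow]
    exact I_le_M hd hn (sub_mem hd (by omega) h1 hc h (Ideal.subset_span (by simp)))
  have hy : sub G (X 1) ∈ M := by
    apply mem_M_of_pow (k := d - 2)
    rw [← map_pow]
    exact I_le_M hd hn (sub_mem hd (by omega) h1 hc h (Ideal.subset_span (by simp)))
  apply not_mem hd (show 2 ≤ m by omega)
  rw [← h2 (X 0 ^ (m-2) * X 1 ^ (d-3))]
  apply sub_mem hd hn h2 hc' h'
  apply pow_M_le (k := (m - 2) + (d - 3)) (by omega)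
  rw [pow_add, map_mul, map_pow, map_pow]
  exact Ideal.mul_mem_mul (Ideal.pow_mem_pow hx _) (Ideal.pow_mem_pow hy _)

lemma proper {d n : ℕ} (hd : 3 ≤ d) (K : Set (ℂ × ℂ)) (hK : IsCompact K) :
    IsCompact ((fdn d n).evalMap ⁻¹' K) := by
  have he : (fdn d n).evalMap = fun z : ℂ × ℂ => (z.1, z.2 ^ d - d * z.1 ^ n * z.2) := by
    funext z; simp [PolyPair.evalMap, fdn]
  rw [he]
  obtain ⟨r, hr⟩ := hK.isBounded.exists_norm_le
  have hcont : Continuous (fun z : ℂ × ℂ => (z.1, z.2 ^ d - d * z.1 ^ n * z.2)) := by fun_prop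
  apply Metric.isCompact_of_isClosed_isBounded (hK.isClosed.preimage hcont)
  rw [isBounded_iff_forall_norm_le]
  set B : ℝ := 1 + |r| + d * |r| ^ n with hB
  have hBr : 0 ≤ d * |r| ^ n := by positivity
  refine ⟨B, ?_⟩
  rintro ⟨x, y⟩ hxy
  have h := hr _ hxy
  have h1 : ‖x‖ ≤ |r| := ((norm_fst_le _).trans h).trans (le_abs_self r)
  have h2 : ‖y ^ d - d * x ^ n * y‖ ≤ |r| := ((norm_snd_le _).trans h).trans (le_abs_self r)
  have h3 : ‖y‖ ^ d ≤ |r| + d * |r| ^ n * ‖y‖ := by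
    calc ‖y‖ ^ d = ‖(y ^ d - d * x ^ n * y) + d * x ^ n * y‖ := by simp
      _ ≤ _ := norm_add_le _ _
      _ ≤ _ := by
        gcongr
        rw [norm_mul, norm_mul, norm_pow, Complex.norm_natCast]
        gcongr
  refine max_le (by have := abs_nonneg r; simp only []; linarith) ?_
  by_contra hlt
  push Not at hlt
  simp only at hlt
  have hr0 := abs_nonneg r
  have hy1 : 1 ≤ ‖y‖ := by linarith
  have h4 : ‖y‖ ^ 2 ≤ ‖y‖ ^ d := pow_le_pow_right₀ hy1 (by omega)
  nlinarith

end FdnAux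

/-- For `d ≥ 3` and `m, n ≥ 2`, the maps `f_{d,n}` and `f_{d,m}` are equivalent iff
`m = n`; in particular (the `f_{d,n}` being proper of topological degree `d`), there
are infinitely many pairwise non-equivalent proper polynomial maps of degree `d`. -/
theorem stmt_10 (d : ℕ) (hd : 3 ≤ d) :
    (∀ m n : ℕ, 2 ≤ m → 2 ≤ n →
      ((fdn d n).Equivalent (fdn d m) ↔ m = n)) ∧
    (∀ n, 2 ≤ n → ∀ K : Set (ℂ × ℂ), IsCompact K →
      IsCompact ((fdn d n).evalMap ⁻¹' K)) ∧
    (∀ k l : ℕ, k ≠ l → ¬ (fdn d (k + 2)).Equivalent (fdn d (l + 2))) := by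
  have main : ∀ m n : ℕ, 2 ≤ m → 2 ≤ n →
      ((fdn d n).Equivalent (fdn d m) ↔ m = n) := by
    intro m n hm hn
    constructor
    · intro h
      have hR := FdnAux.R_of_equiv hd h
      rcases lt_trichotomy m n with hlt | heq | hlt
      · exact absurd (FdnAux.R_symm hR) (FdnAux.not_R hd hm hlt)
      · exact heq
      · exact absurd hR (FdnAux.not_R hd hn hlt)
    · rintro rfl
      have hid : PolyPair.IsPolyAuto (X 0, X 1) :=
        ⟨(X 0, X 1), by simp [FdnAux.evalMap_id], by simp [FdnAux.evalMap_id]⟩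
      exact ⟨(X 0, X 1), (X 0, X 1), hid, hid, by simp [FdnAux.evalMap_id]⟩
  refine ⟨main, fun n _ K hK => FdnAux.proper hd K hK, fun k l hkl h => hkl ?_⟩
  have := (main (l + 2) (k + 2) (by omega) (by omega)).1 h
  omega
end

section
/- The groups G(m, p, 2) and G(m', p', 2) (with p | m, p' | m', and both groups non-abelian) are isomorphic as abstract groups if and only if (m, p) = (m', p'), with the single exception that G(2, 1, 2) ≅ G(4, 4, 2). -/
open Matrix

/-- The set of matrices of the group `G(m,p,2)`: diagonal and antidiagonal matrices
with entries powers `θ^{α₁}, θ^{α₂}` of `θ = exp(2πi/m)` with `α₁ + α₂ ≡ 0 (mod p)`. -/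
noncomputable def Gmat (m p : ℕ) : Set (Matrix (Fin 2) (Fin 2) ℂ) :=
  {A | ∃ α₁ α₂ : ℕ, p ∣ (α₁ + α₂) ∧
    (A = !![Complex.exp (2 * Real.pi * Complex.I / m) ^ α₁, 0;
            0, Complex.exp (2 * Real.pi * Complex.I / m) ^ α₂] ∨
     A = !![0, Complex.exp (2 * Real.pi * Complex.I / m) ^ α₁;
            Complex.exp (2 * Real.pi * Complex.I / m) ^ α₂, 0])}


noncomputable def thG (m : ℕ) : ℂ := Complex.exp (2 * Real.pi * Complex.I / m)

abbrev GLc := Matrix.GeneralLinearGroup (Fin 2) ℂ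

lemma thG_prim {m : ℕ} (hm : m ≠ 0) : IsPrimitiveRoot (thG m) m :=
  Complex.isPrimitiveRoot_exp m hm

lemma thG_ne (m : ℕ) : thG m ≠ 0 := Complex.exp_ne_zero _

lemma mem_GmatG {m p : ℕ} {A : Matrix (Fin 2) (Fin 2) ℂ} : A ∈ Gmat m p ↔
    ∃ α₁ α₂ : ℕ, p ∣ (α₁ + α₂) ∧ (A = !![thG m ^ α₁, 0; 0, thG m ^ α₂] ∨
      A = !![0, thG m ^ α₁; thG m ^ α₂, 0]) := Iff.rfl

lemma memH {m p : ℕ} {H : Subgroup GLc}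
    (hH : (fun A : GLc => (A : Matrix (Fin 2) (Fin 2) ℂ)) '' (H : Set GLc) = Gmat m p)
    (A : GLc) : A ∈ H ↔ (A : Matrix (Fin 2) (Fin 2) ℂ) ∈ Gmat m p := by
  rw [← hH]
  constructor
  · intro h
    exact ⟨A, h, rfl⟩
  · rintro ⟨B, hB, hBA⟩
    have : B = A := Units.ext hBA
    exact this ▸ hB

lemma exH {m p : ℕ} {H : Subgroup GLc}
    (hH : (fun A : GLc => (A : Matrix (Fin 2) (Fin 2) ℂ)) '' (H : Set GLc) = Gmat m p)
    (B : Matrix (Fin 2) (Fin 2) ℂ) (hB : B ∈ Gmat m p) :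
    ∃ A : H, ((A : GLc) : Matrix (Fin 2) (Fin 2) ℂ) = B := by
  rw [← hH] at hB
  obtain ⟨A, hA, h⟩ := hB
  exact ⟨⟨A, hA⟩, h⟩

/-- diagonal elements -/
def isD (A : GLc) : Prop := (A : Matrix (Fin 2) (Fin 2) ℂ) 0 1 = 0 ∧
  (A : Matrix (Fin 2) (Fin 2) ℂ) 1 0 = 0

/-- antidiagonal elements -/
def isAD (A : GLc) : Prop := (A : Matrix (Fin 2) (Fin 2) ℂ) 0 0 = 0 ∧
  (A : Matrix (Fin 2) (Fin 2) ℂ) 1 1 = 0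

lemma D_or_AD {m p : ℕ} {H : Subgroup GLc}
    (hH : (fun A : GLc => (A : Matrix (Fin 2) (Fin 2) ℂ)) '' (H : Set GLc) = Gmat m p)
    (A : H) : isD A ∨ isAD A := by
  obtain ⟨a, b, -, h | h⟩ := mem_GmatG.1 ((memH hH A).1 A.2)
  · left; simp [isD, h]
  · right; simp [isAD, h]

lemma D_pow {m p : ℕ} {H : Subgroup GLc} (hm : m ≠ 0)
    (hH : (fun A : GLc => (A : Matrix (Fin 2) (Fin 2) ℂ)) '' (H : Set GLc) = Gmat m p)
    (A : H) (hA : isD A) : A ^ m = 1 := by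
  obtain ⟨a, b, -, h | h⟩ := mem_GmatG.1 ((memH hH A).1 A.2)
  · apply Subtype.ext
    apply Units.ext
    have h1 : ((A : GLc) : Matrix (Fin 2) (Fin 2) ℂ) = Matrix.diagonal ![thG m ^ a, thG m ^ b] := by
      rw [h]; ext i j; fin_cases i <;> fin_cases j <;> simp
    simp only [Subgroup.coe_pow, Units.val_pow_eq_pow_val, h1, Matrix.diagonal_pow]
    have h2 : ∀ c : ℕ, (thG m ^ c) ^ m = 1 := fun c => by
      rw [← pow_mul, mul_comm, pow_mul, (thG_prim hm).pow_eq_one, one_pow]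
    ext i j; fin_cases i <;> fin_cases j <;> simp [h2]
  · exfalso
    have := hA.1
    rw [h] at this
    simp [thG_ne] at this

lemma D_comm {A B : GLc} (hA : isD A) (hB : isD B) : A * B = B * A := by
  apply Units.ext
  ext i j
  fin_cases i <;> fin_cases j <;>
    simp [Matrix.mul_apply, Fin.sum_univ_two, hA.1, hA.2, hB.1, hB.2, mul_comm]

lemma D_mul {A B : GLc} (hA : isD A) (hB : isD B) : isD (A * B) := by
  constructor <;> simp [Matrix.mul_apply, Fin.sum_univ_two, hA.1, hA.2, hB.1, hB.2]

lemma AD_mul {A B : GLc} (hA : isAD A) (hB : isAD B) : isD (A * B) := by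
  constructor <;> simp [Matrix.mul_apply, Fin.sum_univ_two, hA.1, hA.2, hB.1, hB.2]

lemma det_ne (A : GLc) : (A : Matrix (Fin 2) (Fin 2) ℂ) 0 0 * (A : Matrix (Fin 2) (Fin 2) ℂ) 1 1
   - (A : Matrix (Fin 2) (Fin 2) ℂ) 0 1 * (A : Matrix (Fin 2) (Fin 2) ℂ) 1 0 ≠ 0 := by
  rw [← Matrix.det_fin_two]
  exact ((Matrix.isUnit_iff_isUnit_det _).1 A.isUnit).ne_zero

lemma scalar_of {A B : GLc} (hA : isAD A) (h : A * B = B * A) :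
    (B : Matrix (Fin 2) (Fin 2) ℂ) 0 0 = (B : Matrix (Fin 2) (Fin 2) ℂ) 1 1 := by
  have h1 := congrArg (fun X : GLc => (X : Matrix (Fin 2) (Fin 2) ℂ) 0 1) h
  simp [Matrix.mul_apply, Fin.sum_univ_two, hA.1, hA.2] at h1
  have h2 := det_ne A
  have h3 : (A : Matrix (Fin 2) (Fin 2) ℂ) 0 1 ≠ 0 := by
    intro h3; simp [hA.1, h3] at h2
  rw [mul_comm] at h1
  exact (mul_right_cancel₀ h3 h1).symm

lemma card_H {m p : ℕ} {H : Subgroup GLc} (hm : m ≠ 0) (hp : 0 < p) (hpm : p ∣ m)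
    (hH : (fun A : GLc => (A : Matrix (Fin 2) (Fin 2) ℂ)) '' (H : Set GLc) = Gmat m p) :
    Nat.card H = 2 * (m * (m / p)) := by
  have hm0 : 0 < m := Nat.pos_of_ne_zero hm
  obtain ⟨q, rfl⟩ := hpm
  rw [Nat.mul_div_cancel_left _ hp]
  set m := p * q with hmdef
  have hq : 0 < q := Nat.pos_of_mul_pos_left hm0
  have P := thG_prim hm
  let g : Bool × Fin m × Fin q → Matrix (Fin 2) (Fin 2) ℂ := fun x =>
    if x.1 then !![thG m ^ (x.2.1 : ℕ), 0; 0, thG m ^ ((m - x.2.1) + p * x.2.2 : ℕ)]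
    else !![0, thG m ^ (x.2.1 : ℕ); thG m ^ ((m - x.2.1) + p * x.2.2 : ℕ), 0]
  have key : ∀ (i i' : Fin m) (j j' : Fin q), thG m ^ (i : ℕ) = thG m ^ (i' : ℕ) →
      thG m ^ ((m - i) + p * j : ℕ) = thG m ^ ((m - i') + p * j' : ℕ) → i = i' ∧ j = j' := by
    intro i i' j j' h1 h2
    have e1 : i = i' := Fin.ext (P.pow_inj i.2 i'.2 h1)
    subst e1
    refine ⟨rfl, ?_⟩
    rw [pow_add, pow_add] at h2
    have h3 := mul_left_cancel₀ (pow_ne_zero _ (thG_ne m)) h2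
    have h4 := P.pow_inj (Nat.mul_lt_mul_of_pos_left j.2 hp) (Nat.mul_lt_mul_of_pos_left j'.2 hp) h3
    exact Fin.ext (Nat.eq_of_mul_eq_mul_left hp h4)
  have ginj : Function.Injective g := by
    rintro ⟨b, i, j⟩ ⟨b', i', j'⟩ h
    have h00 := congrFun (congrFun h 0) 0
    have h01 := congrFun (congrFun h 0) 1
    have h10 := congrFun (congrFun h 1) 0
    have h11 := congrFun (congrFun h 1) 1
    cases b <;> cases b'
    · obtain ⟨rfl, rfl⟩ := key _ _ _ _ (by simpa [g] using h01) (by simpa [g] using h10); rfl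
    · exact absurd h01 (by simp [g, thG_ne])
    · exact absurd h00 (by simp [g, thG_ne])
    · obtain ⟨rfl, rfl⟩ := key _ _ _ _ (by simpa [g] using h00) (by simpa [g] using h11); rfl
  have grange : Set.range g = Gmat m p := by
    ext A
    rw [mem_GmatG]
    constructor
    · rintro ⟨⟨b, i, j⟩, rfl⟩
      refine ⟨i, (m - i) + p * j, ?_, ?_⟩
      · have : (i : ℕ) + ((m - i) + p * j) = p * (q + j) := by
          have := i.2
          rw [mul_add, ← hmdef]; omega
        exact ⟨_, this⟩
      · cases b <;> simp [g]
    · rintro ⟨a, b, ⟨k, hk⟩, h⟩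
      have e1 : thG m ^ (a % m) = thG m ^ a := by
        conv_rhs => rw [← Nat.mod_add_div a m, pow_add, pow_mul, P.pow_eq_one, one_pow, mul_one]
      have e2 : thG m ^ ((m - a % m) + p * (k % q)) = thG m ^ b := by
        have hlt := Nat.mod_lt a hm0
        apply mul_left_cancel₀ (pow_ne_zero (a % m) (thG_ne m))
        conv_rhs => rw [e1, ← pow_add, hk, ← Nat.mod_add_div k q, mul_add, ← mul_assoc p q, pow_add,
          ← hmdef, pow_mul (thG m) m, P.pow_eq_one, one_pow, mul_one]
        rw [← pow_add, show a % m + (m - a % m + p * (k % q)) = m + p * (k % q) by omega, pow_add,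
          P.pow_eq_one, one_mul]
      rcases h with rfl | rfl
      · refine ⟨⟨true, ⟨a % m, Nat.mod_lt _ hm0⟩, ⟨k % q, Nat.mod_lt _ hq⟩⟩, ?_⟩
        simp only [g, if_true, e1, e2]
      · refine ⟨⟨false, ⟨a % m, Nat.mod_lt _ hm0⟩, ⟨k % q, Nat.mod_lt _ hq⟩⟩, ?_⟩
        simp [g, e1, e2]
  have c1 : Nat.card (Gmat m p) = 2 * (m * q) := by
    rw [← grange, Nat.card_range_of_injective ginj]
    simp
  rw [← c1, ← hH, Nat.card_image_of_injective]
  · rfl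
  · exact fun A B h => Units.ext h

lemma m_ne {m p : ℕ} {H : Subgroup GLc}
    (hH : (fun A : GLc => (A : Matrix (Fin 2) (Fin 2) ℂ)) '' (H : Set GLc) = Gmat m p)
    (hna : ¬ ∀ a ∈ H, ∀ b ∈ H, a * b = b * a) (h : thG m = 1) : False := by
  apply hna
  intro a ha b hb
  obtain ⟨a1, a2, -, ha⟩ := mem_GmatG.1 ((memH hH a).1 ha)
  obtain ⟨b1, b2, -, hb⟩ := mem_GmatG.1 ((memH hH b).1 hb)
  apply Units.ext
  simp only [h, one_pow] at ha hb
  rcases ha with ha | ha <;> rcases hb with hb | hb <;> simp [ha, hb]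

lemma thG_zero : thG 0 = 1 := by simp [thG]
lemma thG_one : thG 1 = 1 := by simpa using (thG_prim one_ne_zero).pow_eq_one
lemma thG_two : thG 2 = -1 := (thG_prim two_ne_zero).eq_neg_one_of_two_right
lemma thG_four : thG 4 = Complex.I := by
  rw [thG, show (2 * Real.pi * Complex.I / ((4:ℕ):ℂ)) = (Real.pi / 2 * Complex.I) by push_cast; ring]
  exact Complex.exp_pi_div_two_mul_I

lemma not22 {H : Subgroup GLc}
    (hH : (fun A : GLc => (A : Matrix (Fin 2) (Fin 2) ℂ)) '' (H : Set GLc) = Gmat 2 2)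
    (hna : ¬ ∀ a ∈ H, ∀ b ∈ H, a * b = b * a) : False := by
  apply hna
  have key : ∀ a b : ℕ, 2 ∣ a + b → thG 2 ^ a = thG 2 ^ b := by
    intro a b h
    rw [thG_two]
    have h1 : ((-1 : ℂ)) ^ (a + b) = 1 := Even.neg_one_pow (even_iff_two_dvd.2 h)
    have h2 : ((-1 : ℂ)) ^ (b + b) = 1 := Even.neg_one_pow ⟨b, rfl⟩
    rw [pow_add] at h1 h2
    exact mul_right_cancel₀ (pow_ne_zero b (by norm_num)) (h1.trans h2.symm)
  intro a ha b hb
  obtain ⟨a1, a2, ka, ha⟩ := mem_GmatG.1 ((memH hH a).1 ha)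
  obtain ⟨b1, b2, kb, hb⟩ := mem_GmatG.1 ((memH hH b).1 hb)
  apply Units.ext
  rw [key _ _ ka] at ha
  rw [key _ _ kb] at hb
  rcases ha with ha | ha <;> rcases hb with hb | hb <;> simp [ha, hb, mul_comm]

lemma small {m p m' p' : ℕ} {H H' : Subgroup GLc} (hm : m ≠ 0) (hm' : m' ≠ 0)
    (hpm' : p' ∣ m')
    (hH : (fun A : GLc => (A : Matrix (Fin 2) (Fin 2) ℂ)) '' (H : Set GLc) = Gmat m p)
    (hH' : (fun A : GLc => (A : Matrix (Fin 2) (Fin 2) ℂ)) '' (H' : Set GLc) = Gmat m' p')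
    (hna' : ¬ ∀ a ∈ H', ∀ b ∈ H', a * b = b * a) (f : H ≃* H')
    (a : H) (ha : isD a) (hfa : ¬ isD (f a)) :
    (m' = 2 ∧ p' = 1) ∨ (m' = 4 ∧ p' = 2) ∨ (m' = 4 ∧ p' = 4) := by
  have hfa' : isAD (f a) := (D_or_AD hH' (f a)).resolve_left hfa
  have P := thG_prim hm'
  have key : ∀ d : H', (((d * d : H') : GLc) : Matrix (Fin 2) (Fin 2) ℂ) 0 0 =
      (((d * d : H') : GLc) : Matrix (Fin 2) (Fin 2) ℂ) 1 1 := by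
    intro d
    apply scalar_of hfa'
    have h1 : isD ((f.symm d * f.symm d : H) : GLc) := by
      rcases D_or_AD hH (f.symm d) with h | h
      · exact D_mul h h
      · exact AD_mul h h
    have h2 : a * (f.symm d * f.symm d) = (f.symm d * f.symm d) * a := Subtype.ext (D_comm ha h1)
    have h3 := congrArg f h2
    simp only [map_mul, MulEquiv.apply_symm_apply] at h3
    exact congrArg Subtype.val h3
  have k1 : ∀ α β : ℕ, p' ∣ α + β → thG m' ^ (2 * α) = thG m' ^ (2 * β) := by
    intro α β h
    obtain ⟨d, hd⟩ := exH hH' !![thG m' ^ α, 0; 0, thG m' ^ β] ⟨α, β, h, Or.inl rfl⟩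
    have := key d
    simp only [Subgroup.coe_mul, Units.val_mul, hd] at this
    simp at this
    rw [two_mul, two_mul, pow_add, pow_add]
    exact this
  have h4 : m' ∣ 4 := by
    rw [← P.pow_eq_one_iff_dvd]
    have := k1 1 (m' - 1) (by rwa [Nat.add_sub_cancel' (Nat.pos_of_ne_zero hm')])
    have e : thG m' ^ 4 = thG m' ^ (2 * 1) * thG m' ^ (2 * 1) := by ring
    rw [e]
    nth_rw 2 [this]
    rw [← pow_add, ← mul_add, Nat.add_sub_cancel' (Nat.pos_of_ne_zero hm'), mul_comm, pow_mul,
      P.pow_eq_one, one_pow]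
  have h2 : m' ∣ 2 * p' := by
    rw [← P.pow_eq_one_iff_dvd]
    simpa using (k1 0 p' (by simp)).symm
  have hle := Nat.le_of_dvd (by norm_num) h4
  have hp4 := Nat.le_of_dvd (Nat.pos_of_ne_zero hm') hpm'
  have hp4' : p' ≤ 4 := hp4.trans hle
  interval_cases m'
  · omega
  · exact (m_ne hH' hna' thG_one).elim
  · interval_cases p'
    · omega
    · simp
    · exact (not22 hH' hna').elim
  · omega
  · interval_cases p' <;> omega

lemma inv_D {m p m' p' : ℕ} {H H' : Subgroup GLc}
    (hH : (fun A : GLc => (A : Matrix (Fin 2) (Fin 2) ℂ)) '' (H : Set GLc) = Gmat m p)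
    (hH' : (fun A : GLc => (A : Matrix (Fin 2) (Fin 2) ℂ)) '' (H' : Set GLc) = Gmat m' p')
    (f : H ≃* H')
    (a : H) (ha : isD a) (hfa : ¬ isD (f a)) : ∃ b : H', isD b ∧ ¬ isD (f.symm b) := by
  by_contra! hc
  have hfa' : isAD (f a) := (D_or_AD hH' (f a)).resolve_left hfa
  obtain ⟨s, hs⟩ := exH hH !![0, 1; 1, 0] ⟨0, 0, by simp, Or.inr (by simp)⟩
  have hsD : ¬ isD s := by
    intro h
    have := h.1
    simp [hs] at this
  rcases D_or_AD hH' (f s) with h | h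
  · exact hsD (by simpa using hc _ h)
  · have h1 := hc (f a * f s) (AD_mul hfa' h)
    rw [← map_mul, MulEquiv.symm_apply_apply] at h1
    have h2 := h1.1
    have h3 := det_ne a
    simp [hs, Matrix.mul_apply, Fin.sum_univ_two] at h2
    simp [h2, ha.1] at h3

lemma m_dvd {m p m' p' : ℕ} {H H' : Subgroup GLc} (hm : m ≠ 0) (hm' : m' ≠ 0) (hpm : p ∣ m)
    (hH : (fun A : GLc => (A : Matrix (Fin 2) (Fin 2) ℂ)) '' (H : Set GLc) = Gmat m p)
    (hH' : (fun A : GLc => (A : Matrix (Fin 2) (Fin 2) ℂ)) '' (H' : Set GLc) = Gmat m' p')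
    (f : H ≃* H') (hf : ∀ a : H, isD a → isD (f a)) : m ∣ m' := by
  obtain ⟨d, hd⟩ := exH hH !![thG m ^ 1, 0; 0, thG m ^ (m - 1)]
    ⟨1, m - 1, by rwa [Nat.add_sub_cancel' (Nat.pos_of_ne_zero hm)], Or.inl rfl⟩
  have h1 := D_pow hm' hH' (f d) (hf d (by simp [isD, hd]))
  rw [← map_pow, map_eq_one_iff f f.injective] at h1
  rw [← (thG_prim hm).pow_eq_one_iff_dvd]
  have h1' : ((d : GLc) : Matrix (Fin 2) (Fin 2) ℂ) = Matrix.diagonal ![thG m ^ 1, thG m ^ (m - 1)] := by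
    rw [hd]; ext i j; fin_cases i <;> fin_cases j <;> simp
  have h2 := congrArg (fun X : H => ((X : GLc) : Matrix (Fin 2) (Fin 2) ℂ) 0 0) h1
  simpa [h1', Matrix.diagonal_pow] using h2

lemma exc {H H' : Subgroup GLc}
    (hH : (fun A : GLc => (A : Matrix (Fin 2) (Fin 2) ℂ)) '' (H : Set GLc) = Gmat 2 1)
    (hH' : (fun A : GLc => (A : Matrix (Fin 2) (Fin 2) ℂ)) '' (H' : Set GLc) = Gmat 4 4) :
    Nonempty (H ≃* H') := by
  let Q : GLc := Matrix.GeneralLinearGroup.mkOfDetNeZero !![1, 1; Complex.I, -Complex.I] (by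
    rw [Matrix.det_fin_two]
    simp [← two_mul, sub_eq_add_neg])
  have hQ : (Q : Matrix (Fin 2) (Fin 2) ℂ) = !![1, 1; Complex.I, -Complex.I] := rfl
  let c : GLc →* GLc := (MulAut.conj Q⁻¹).toMonoidHom
  have cinj : Function.Injective c := (MulAut.conj Q⁻¹).injective
  have I2 := Complex.I_sq
  have I3 : Complex.I ^ 3 = -Complex.I := Complex.I_pow_three
  have main : ∀ A ∈ H, ∃ B ∈ Gmat 4 4,
      (A : Matrix (Fin 2) (Fin 2) ℂ) * !![1, 1; Complex.I, -Complex.I] =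
       !![1, 1; Complex.I, -Complex.I] * B := by
    intro A hA
    obtain ⟨a, b, -, h⟩ := mem_GmatG.1 ((memH hH A).1 hA)
    rw [thG_two] at h
    simp only [mem_GmatG, thG_four]
    rcases neg_one_pow_eq_or ℂ a with ea | ea <;> rcases neg_one_pow_eq_or ℂ b with eb | eb <;>
      rw [ea, eb] at h <;> rcases h with h | h <;> rw [h]
    · exact ⟨_, ⟨0, 0, by norm_num, Or.inl rfl⟩, by simp⟩
    · exact ⟨_, ⟨3, 1, by norm_num, Or.inr rfl⟩, by simp [I3]⟩
    · exact ⟨_, ⟨0, 0, by norm_num, Or.inr rfl⟩, by simp⟩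
    · exact ⟨_, ⟨1, 3, by norm_num, Or.inl rfl⟩, by simp [I3]⟩
    · exact ⟨_, ⟨2, 2, by norm_num, Or.inr rfl⟩, by simp⟩
    · exact ⟨_, ⟨3, 1, by norm_num, Or.inl rfl⟩, by simp [I3]⟩
    · exact ⟨_, ⟨2, 2, by norm_num, Or.inl rfl⟩, by simp⟩
    · exact ⟨_, ⟨1, 3, by norm_num, Or.inr rfl⟩, by simp [I3]⟩
  have le : H.map c ≤ H' := by
    rintro _ ⟨A, hA, rfl⟩
    obtain ⟨B, hB, h⟩ := main A hA
    obtain ⟨B', hB'⟩ := exH hH' B hB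
    have h1 : A * Q = Q * B' := by
      apply Units.ext
      rw [Units.val_mul, Units.val_mul, hB', hQ, h]
    have h2 : c A = B' := by
      simp only [c, MulEquiv.toMonoidHom_eq_coe, MonoidHom.coe_coe, MulAut.conj_apply, inv_inv]
      rw [mul_assoc, h1, inv_mul_cancel_left]
    rw [h2]
    exact B'.2
  have c1 : Nat.card H = 8 := by simpa using card_H two_ne_zero one_pos (by norm_num) hH
  have c2 : Nat.card H' = 8 := by simpa using card_H four_ne_zero (by norm_num) (by norm_num) hH'
  have e := H.equivMapOfInjective c cinj
  have c3 : Nat.card (H.map c) = 8 := by rw [← Nat.card_congr e.toEquiv, c1]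
  have : Finite H' := Nat.finite_of_card_ne_zero (by omega)
  have : H.map c = H' := Subgroup.eq_of_le_of_card_ge le (by omega)
  exact ⟨this ▸ e⟩

/-- Two non-abelian groups `G(m,p,2)` and `G(m',p',2)` are isomorphic as abstract
groups iff `(m,p) = (m',p')`, with the single exception `G(2,1,2) ≅ G(4,4,2)`. -/
theorem stmt_16 (m p m' p' : ℕ) (hp : 0 < p) (hp' : 0 < p')
    (hpm : p ∣ m) (hpm' : p' ∣ m')
    (H H' : Subgroup (Matrix.GeneralLinearGroup (Fin 2) ℂ))
    (hH : (fun A : Matrix.GeneralLinearGroup (Fin 2) ℂ => (A : Matrix (Fin 2) (Fin 2) ℂ))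
        '' (H : Set (Matrix.GeneralLinearGroup (Fin 2) ℂ)) = Gmat m p)
    (hH' : (fun A : Matrix.GeneralLinearGroup (Fin 2) ℂ => (A : Matrix (Fin 2) (Fin 2) ℂ))
        '' (H' : Set (Matrix.GeneralLinearGroup (Fin 2) ℂ)) = Gmat m' p')
    (hna : ¬ ∀ a ∈ H, ∀ b ∈ H, a * b = b * a)
    (hna' : ¬ ∀ a ∈ H', ∀ b ∈ H', a * b = b * a) :
    Nonempty (H ≃* H') ↔
      ((m = m' ∧ p = p') ∨
       (m = 2 ∧ p = 1 ∧ m' = 4 ∧ p' = 4) ∨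
       (m = 4 ∧ p = 4 ∧ m' = 2 ∧ p' = 1)) := by
  have hm : m ≠ 0 := by rintro rfl; exact m_ne hH hna thG_zero
  have hm' : m' ≠ 0 := by rintro rfl; exact m_ne hH' hna' thG_zero
  constructor
  · rintro ⟨f⟩
    have hc : 2 * (m * (m / p)) = 2 * (m' * (m' / p')) := by
      rw [← card_H hm hp hpm hH, ← card_H hm' hp' hpm' hH', Nat.card_congr f.toEquiv]
    have gen : (∃ a : H, isD a ∧ ¬ isD (f a)) → (∃ b : H', isD b ∧ ¬ isD (f.symm b)) →
        ((m = m' ∧ p = p') ∨ (m = 2 ∧ p = 1 ∧ m' = 4 ∧ p' = 4) ∨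
        (m = 4 ∧ p = 4 ∧ m' = 2 ∧ p' = 1)) := by
      rintro ⟨a, ha, hfa⟩ ⟨b, hb, hfb⟩
      have r1 := small hm hm' hpm' hH hH' hna' f a ha hfa
      have r2 := small hm' hm hpm hH' hH hna f.symm b hb hfb
      rcases r1 with ⟨rfl, rfl⟩ | ⟨rfl, rfl⟩ | ⟨rfl, rfl⟩ <;>
        rcases r2 with ⟨rfl, rfl⟩ | ⟨rfl, rfl⟩ | ⟨rfl, rfl⟩ <;> simp at hc ⊢
    by_cases h1 : ∃ a : H, isD a ∧ ¬ isD (f a)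
    · obtain ⟨a, ha, hfa⟩ := h1
      exact gen ⟨a, ha, hfa⟩ (inv_D hH hH' f a ha hfa)
    by_cases h2 : ∃ b : H', isD b ∧ ¬ isD (f.symm b)
    · obtain ⟨b, hb, hfb⟩ := h2
      exact gen (inv_D hH' hH f.symm b hb hfb) ⟨b, hb, hfb⟩
    push Not at h1 h2
    have e : m = m' := Nat.dvd_antisymm (m_dvd hm hm' hpm hH hH' f h1)
      (m_dvd hm' hm hpm' hH' hH f.symm h2)
    subst e
    left
    refine ⟨rfl, ?_⟩
    have h3 : m / p = m / p' :=
      Nat.eq_of_mul_eq_mul_left (Nat.pos_of_ne_zero hm) (Nat.eq_of_mul_eq_mul_left two_pos hc)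
    have h4 := Nat.mul_div_cancel' hpm
    have h5 := Nat.mul_div_cancel' hpm'
    rw [h3] at h4
    have h6 : 0 < m / p' := Nat.div_pos (Nat.le_of_dvd (Nat.pos_of_ne_zero hm) hpm') hp'
    exact Nat.eq_of_mul_eq_mul_right h6 (h4.trans h5.symm)
  · rintro (⟨rfl, rfl⟩ | ⟨rfl, rfl, rfl, rfl⟩ | ⟨rfl, rfl, rfl, rfl⟩)
    · have : H = H' := by
        ext A
        rw [memH hH, memH hH']
      subst this
      exact ⟨MulEquiv.refl _⟩
    · exact exc hH hH'
    · exact ⟨(exc hH' hH).some.symm⟩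
end
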